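/- arXiv:1609.05207 — 5 statements merged into one kernel-verified Lean document; each statement's English description precedes it below -/
import Mathlib

section
/- Let a conjunctive linear loop program over ℝ^n be given by A ∈ ℝ^{m×2n} and b ∈ ℝ^m, together with a stem relation S ⊆ ℝ^n × ℝ^n. If there exists a geometric nontermination argument (x_0, x_1, y_1, …, y_k, λ_1, …, λ_k, μ_1, …, μ_{k-1}) for this lasso program, then the lasso program is nonterminating; explicitly, setting Y = (y_1 … y_k) ∈ ℝ^{n×k} and U ∈ ℝ^{k×k} the upper bidiagonal matrix with U_{ii} = λ_i and U_{i,i+1} = μ_i, the sequence x_0, x_1, x_1 + Y·1, x_1 + Y·1 + YU·1, x_1 + Y·1 + YU·1 + YU²·1, … (where 1 is the all-ones vector in ℝ^k) is an infinite execution of the lasso program. -/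
open Matrix Finset

/-- The matrix `Y` whose columns are the vectors `y_1, …, y_k`. -/
def Ymat {n k : ℕ} (y : Fin k → Fin n → ℝ) : Matrix (Fin n) (Fin k) ℝ :=
  Matrix.of fun i j => y j i

/-- The upper bidiagonal matrix `U` with `U_{ii} = λ_i` and `U_{i,i+1} = μ_i`. -/
def Umat {k : ℕ} (lam : Fin k → ℝ) (mu : Fin (k - 1) → ℝ) : Matrix (Fin k) (Fin k) ℝ :=
  Matrix.of fun i j =>
    if (i : ℕ) = (j : ℕ) then lam i
    else if h : (j : ℕ) = (i : ℕ) + 1 then mu ⟨(i : ℕ), by have := j.isLt; omega⟩ else 0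

/-- Nonpositivity of `A (M_i; N_i)` for all columns extends to nonnegative combinations. -/
theorem mulVec_elim_mulVec_nonpos {m n k : Type*} [Fintype n] [Fintype k]
    (A : Matrix m (n ⊕ n) ℝ) (M N : Matrix n k ℝ)
    (h : ∀ i, A *ᵥ Sum.elim (M.col i) (N.col i) ≤ 0) {v : k → ℝ} (hv : 0 ≤ v) :
    A *ᵥ Sum.elim (M *ᵥ v) (N *ᵥ v) ≤ 0 := by
  rw [← Matrix.fromRows_mulVec, Matrix.mulVec_mulVec]
  intro r
  refine Finset.sum_nonpos fun i _ => mul_nonpos_of_nonpos_of_nonneg ?_ (hv i)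
  have hcol : Sum.elim (M.col i) (N.col i) = (Matrix.fromRows M N).col i := by
    ext (j | j) <;> rfl
  have hr := h i r
  rwa [hcol] at hr

theorem Umat_nonneg {k : ℕ} {lam : Fin k → ℝ} {mu : Fin (k - 1) → ℝ}
    (hlam : ∀ i, 0 ≤ lam i) (hmu : ∀ i, 0 ≤ mu i) (i j : Fin k) : 0 ≤ Umat lam mu i j := by
  simp only [Umat, Matrix.of_apply]
  split_ifs
  exacts [hlam _, hmu _, le_rfl]

theorem Umat_pow_mulVec_one_nonneg {k : ℕ} {lam : Fin k → ℝ} {mu : Fin (k - 1) → ℝ}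
    (hlam : ∀ i, 0 ≤ lam i) (hmu : ∀ i, 0 ≤ mu i) (t : ℕ) :
    0 ≤ (Umat lam mu ^ t) *ᵥ (fun _ => (1 : ℝ)) := by
  induction t with
  | zero => intro i; simp
  | succ t ih =>
    rw [pow_succ', ← Matrix.mulVec_mulVec]
    intro i
    simp only [Matrix.mulVec, dotProduct, Pi.zero_apply] at ih ⊢
    exact Finset.sum_nonneg fun j _ => mul_nonneg (Umat_nonneg hlam hmu i j) (ih j)

theorem Ymat_mulVec_one {n k : ℕ} (y : Fin k → Fin n → ℝ) :
    Ymat y *ᵥ (fun _ => (1 : ℝ)) = ∑ i, y i := by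
  ext r
  simp [Ymat, Matrix.mulVec, dotProduct]

theorem Ymat_mul_Umat_col_of_eq_zero {n k : ℕ} (y : Fin k → Fin n → ℝ) (lam : Fin k → ℝ)
    (mu : Fin (k - 1) → ℝ) {i : Fin k} (hi : (i : ℕ) = 0) :
    (Ymat y * Umat lam mu).col i = lam i • y i := by
  ext r
  simp only [Matrix.col_apply, Matrix.mul_apply, Ymat, Umat, Matrix.of_apply,
    Pi.smul_apply, smul_eq_mul]
  rw [Finset.sum_eq_single i, if_pos rfl, mul_comm]
  · intro l _ hne
    have h₁ : ¬ (l : ℕ) = i := fun e => hne (Fin.ext e)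
    have h₂ : ¬ (i : ℕ) = l + 1 := by omega
    simp [h₁, h₂]
  · simp

theorem Ymat_mul_Umat_col_of_eq_succ {n k : ℕ} (y : Fin k → Fin n → ℝ) (lam : Fin k → ℝ)
    (mu : Fin (k - 1) → ℝ) {i l : Fin k} {p : Fin (k - 1)} (hi : (i : ℕ) = l + 1)
    (hp : (p : ℕ) = l) :
    (Ymat y * Umat lam mu).col i = lam i • y i + mu p • y l := by
  ext r
  have hli : ¬ (l : ℕ) = i := by omega
  simp only [Matrix.col_apply, Matrix.mul_apply, Ymat, Umat, Matrix.of_apply, Pi.add_apply,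
    Pi.smul_apply, smul_eq_mul]
  rw [Finset.sum_eq_add_of_mem i l (Finset.mem_univ _) (Finset.mem_univ _)
    fun e => hli (congrArg Fin.val e.symm), if_pos rfl, if_neg hli, dif_pos hi,
    mul_comm (lam i), mul_comm (mu p)]
  · simp only [← hp, Fin.eta]
  · rintro j - ⟨hji, hjl⟩
    have h₁ : ¬ (j : ℕ) = i := fun e => hji (Fin.ext e)
    have h₂ : ¬ (i : ℕ) = j + 1 := fun e => hjl (Fin.ext (by omega))
    simp [h₁, h₂]

/-- **Soundness of geometric nontermination arguments.**
If `(x₀, x₁, y₁, …, y_k, λ₁, …, λ_k, μ₁, …, μ_{k-1})` is a geometric nontermination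
argument for the lasso program with stem relation `S` and loop transition
`{(x,x') : A (x;x') ≤ b}`, then the sequence
`x₀, x₁, x₁ + Y·1, x₁ + Y·1 + YU·1, …` is an infinite execution of the lasso program. -/
theorem gnta_soundness {n m k : ℕ}
    (A : Matrix (Fin m) (Fin n ⊕ Fin n) ℝ) (b : Fin m → ℝ)
    (S : (Fin n → ℝ) → (Fin n → ℝ) → Prop)
    (x0 x1 : Fin n → ℝ) (y : Fin k → Fin n → ℝ)
    (lam : Fin k → ℝ) (mu : Fin (k - 1) → ℝ)
    -- (domain)
    (hlam : ∀ i, 0 ≤ lam i) (hmu : ∀ i, 0 ≤ mu i)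
    -- (initiation)
    (hinit : S x0 x1)
    -- (point)
    (hpoint : A *ᵥ Sum.elim x1 (x1 + ∑ i, y i) ≤ b)
    -- (ray)
    (hray : ∀ i : Fin k,
      A *ᵥ Sum.elim (y i)
        (lam i • y i +
          if h : 0 < (i : ℕ) then
            mu ⟨(i : ℕ) - 1, by have := i.isLt; omega⟩ •
              y ⟨(i : ℕ) - 1, by have := i.isLt; omega⟩
          else 0) ≤ 0) :
    -- the explicitly given sequence is an infinite execution of the lasso program
    ∃ χ : ℕ → Fin n → ℝ,
      χ 0 = x0 ∧
      (∀ t : ℕ, χ (t + 1) =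
        x1 + ∑ j ∈ Finset.range t, (Ymat y * Umat lam mu ^ j) *ᵥ (fun _ => (1 : ℝ))) ∧
      S (χ 0) (χ 1) ∧
      (∀ t : ℕ, 1 ≤ t → A *ᵥ Sum.elim (χ t) (χ (t + 1)) ≤ b) := by
  refine ⟨fun t => Nat.casesOn t x0 fun t =>
    x1 + ∑ j ∈ Finset.range t, (Ymat y * Umat lam mu ^ j) *ᵥ (fun _ => (1 : ℝ)),
    rfl, fun _ => rfl, by simpa using hinit, fun t ht => ?_⟩
  obtain ⟨t, rfl⟩ := Nat.exists_eq_add_of_le' ht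
  clear ht
  induction t with
  | zero => simpa [Ymat_mulVec_one] using hpoint
  | succ t ih =>
    have hstep : A *ᵥ Sum.elim ((Ymat y * Umat lam mu ^ t) *ᵥ (fun _ => (1 : ℝ)))
        ((Ymat y * Umat lam mu ^ (t + 1)) *ᵥ (fun _ => (1 : ℝ))) ≤ 0 := by
      rw [pow_succ', ← Matrix.mul_assoc, ← Matrix.mulVec_mulVec, ← Matrix.mulVec_mulVec]
      refine mulVec_elim_mulVec_nonpos A _ _ (fun i => ?_)
        (Umat_pow_mulVec_one_nonneg hlam hmu t)
      have hi := hray i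
      split_ifs at hi with h
      · rwa [Ymat_mul_Umat_col_of_eq_succ y lam mu (i := i) (l := ⟨i - 1, by omega⟩)
          (p := ⟨i - 1, by omega⟩) (Nat.sub_add_cancel h).symm rfl]
      · rwa [Ymat_mul_Umat_col_of_eq_zero y lam mu (Nat.eq_zero_of_not_pos h), ← add_zero (_ • _)]
    have hsum := add_le_add ih hstep
    rw [← Matrix.mulVec_add, add_zero, ← Sum.elim_add_add] at hsum
    simpa only [Finset.sum_range_succ, add_assoc] using hsum
end

section
/- Let a conjunctive linear loop program over ℝ^n be given by A ∈ ℝ^{m×2n} and b ∈ ℝ^m with loop transition relation T = {(x,x') : A(x;x') ≤ b}. Then the loop has a bounded infinite execution (i.e., an infinite sequence x_1, x_2, … with (x_t, x_{t+1}) ∈ T for all t ≥ 1 and ‖x_t‖ ≤ d for some d ∈ ℝ and all t) if and only if there exists a fixed point x* ∈ ℝ^n with (x*, x*) ∈ T. -/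
open Matrix

/-- A closed convex relation on a finite-dimensional (more generally, proper) normed space that
admits a bounded infinite orbit has a fixed point, namely any limit point of the Cesàro averages
of the orbit. -/
theorem exists_diag_mem_of_bounded_orbit {E : Type*} [NormedAddCommGroup E] [NormedSpace ℝ E]
    [ProperSpace E] {T : Set (E × E)} (hconv : Convex ℝ T) (hclosed : IsClosed T)
    {x : ℕ → E} {d : ℝ} (hx : ∀ t, (x t, x (t + 1)) ∈ T) (hd : ∀ t, ‖x t‖ ≤ d) :
    ∃ y, (y, y) ∈ T := by
  let c : ℕ → ℝ := fun k => ((k : ℝ) + 1)⁻¹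
  have hc0 : ∀ k, 0 ≤ c k := fun k => by positivity
  have hc1 : ∀ k, ∑ _t ∈ Finset.range (k + 1), c k = 1 := fun k => by
    have : (k : ℝ) + 1 ≠ 0 := by positivity
    simp [c, this]
  let avg : ℕ → E := fun k => ∑ t ∈ Finset.range (k + 1), c k • x t
  let err : ℕ → E := fun k => c k • (x (k + 1) - x 0)
  have hball : ∀ k, avg k ∈ Metric.closedBall (0 : E) d := fun k =>
    (convex_closedBall (0 : E) d).sum_mem (fun _ _ => hc0 k) (hc1 k)
      fun t _ => by simpa using hd t
  have hmem : ∀ k, (avg k, avg k + err k) ∈ T := fun k => by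
    have h := hconv.sum_mem (t := Finset.range (k + 1)) (fun _ _ => hc0 k) (hc1 k)
      fun t _ => hx t
    convert h using 1
    ext1
    · simp [avg, Prod.fst_sum]
    · simp only [avg, err, Prod.snd_sum, Prod.smul_snd, ← Finset.smul_sum, ← smul_add,
        ← Finset.sum_range_sub x (k + 1), ← Finset.sum_add_distrib, add_sub_cancel]
  have herr : Filter.Tendsto err Filter.atTop (nhds 0) := by
    have hc : Filter.Tendsto c Filter.atTop (nhds 0) := by
      simpa [c, one_div] using tendsto_one_div_add_atTop_nhds_zero_nat (𝕜 := ℝ)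
    refine squeeze_zero_norm (a := fun k => c k * (d + d)) (fun k => ?_) ?_
    · rw [norm_smul, Real.norm_of_nonneg (hc0 k)]
      exact mul_le_mul_of_nonneg_left
        ((norm_sub_le _ _).trans (add_le_add (hd _) (hd _))) (hc0 k)
    · simpa using hc.mul_const (d + d)
  obtain ⟨y, -, φ, hφ, hy⟩ := (isCompact_closedBall (0 : E) d).tendsto_subseq hball
  have hy' : Filter.Tendsto (fun k => avg (φ k) + err (φ k)) Filter.atTop (nhds y) := by
    simpa using hy.add (herr.comp hφ.tendsto_atTop)
  exact ⟨y, hclosed.mem_of_tendsto (hy.prodMk_nhds hy') (.of_forall fun k => hmem (φ k))⟩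

/-- **Fixed point lemma.**
A conjunctive linear loop program `{(x,x') : A (x;x') ≤ b}` has a bounded infinite
execution if and only if it has a fixed point `x*` with `A (x*;x*) ≤ b`. -/
theorem bounded_infinite_execution_iff_fixed_point {n m : ℕ}
    (A : Matrix (Fin m) (Fin n ⊕ Fin n) ℝ) (b : Fin m → ℝ) :
    (∃ (x : ℕ → EuclideanSpace ℝ (Fin n)) (d : ℝ),
      (∀ t : ℕ, A *ᵥ Sum.elim (x t) (x (t + 1)) ≤ b) ∧ (∀ t : ℕ, ‖x t‖ ≤ d)) ↔
    (∃ xstar : EuclideanSpace ℝ (Fin n), A *ᵥ Sum.elim xstar xstar ≤ b) := by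
  constructor
  · rintro ⟨x, d, hx, hd⟩
    let f : EuclideanSpace ℝ (Fin n) × EuclideanSpace ℝ (Fin n) →ₗ[ℝ] Fin m → ℝ :=
      { toFun := fun p => A *ᵥ Sum.elim p.1 p.2
        map_add' := fun p q => by
          rw [← mulVec_add]
          congr 1
          ext (i | i) <;> simp
        map_smul' := fun r p => by
          rw [RingHom.id_apply, ← mulVec_smul]
          congr 1
          ext (i | i) <;> simp }
    exact exists_diag_mem_of_bounded_orbit (T := f ⁻¹' Set.Iic b)
      ((convex_Iic b).linear_preimage f)
      (isClosed_Iic.preimage f.continuous_of_finiteDimensional) hx hd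
  · rintro ⟨y, hy⟩
    exact ⟨fun _ => y, ‖y‖, fun _ => hy, fun _ => le_rfl⟩
end

section
/- Let a conjunctive linear loop program over ℝ^n be given by A ∈ ℝ^{m×2n} and b ∈ ℝ^m with loop transition relation T = {(x,x') : A(x;x') ≤ b}. If the loop has a bounded infinite execution, then it has a geometric nontermination argument of size 0; that is, there exists x* ∈ ℝ^n such that A(x*; x*) ≤ b. -/
open Matrix

open Filter Topology

/-- A closed convex relation containing all steps of a bounded orbit has a fixed point: a cluster
point of the Cesàro means of the orbit. -/
theorem exists_diagonal_mem_of_bounded_orbit {E : Type*} [NormedAddCommGroup E]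
    [NormedSpace ℝ E] [ProperSpace E] {S : Set (E × E)} (hconv : Convex ℝ S)
    (hclosed : IsClosed S) (x : ℕ → E) (d : ℝ) (hS : ∀ t, (x t, x (t + 1)) ∈ S)
    (hx : ∀ t, ‖x t‖ ≤ d) : ∃ y, (y, y) ∈ S := by
  let mean : ℕ → E := fun N => ∑ t ∈ Finset.range (N + 1), ((N : ℝ) + 1)⁻¹ • x t
  have hw (N : ℕ) : ∑ _t ∈ Finset.range (N + 1), ((N : ℝ) + 1)⁻¹ = 1 := by
    rw [Finset.sum_const, Finset.card_range, nsmul_eq_mul]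
    push_cast
    exact mul_inv_cancel₀ (by positivity)
  have hmean_ball (N : ℕ) : mean N ∈ Metric.closedBall (0 : E) d :=
    (convex_closedBall (0 : E) d).sum_mem (fun _ _ => by positivity) (hw N)
      fun t _ => mem_closedBall_zero_iff.2 (hx t)
  have hmean_mem (N : ℕ) :
      (mean N, mean N + ((N : ℝ) + 1)⁻¹ • (x (N + 1) - x 0)) ∈ S := by
    have h := hconv.sum_mem (t := Finset.range (N + 1)) (w := fun _ => ((N : ℝ) + 1)⁻¹)
      (z := fun t => (x t, x (t + 1))) (fun _ _ => by positivity) (hw N) fun t _ => hS t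
    convert h using 1
    refine Prod.ext ?_ ?_
    · simp [mean, Prod.fst_sum]
    · rw [Prod.snd_sum]
      simp only [mean, Prod.smul_snd, ← Finset.smul_sum]
      rw [← smul_add, ← Finset.sum_range_sub, ← Finset.sum_add_distrib]
      simp
  have hshift : Tendsto (fun N : ℕ => ((N : ℝ) + 1)⁻¹ • (x (N + 1) - x 0)) atTop (𝓝 0) := by
    have hinv : Tendsto (fun N : ℕ => ((N : ℝ) + 1)⁻¹ * (d + d)) atTop (𝓝 0) := by
      simpa using (tendsto_one_div_add_atTop_nhds_zero_nat (𝕜 := ℝ)).mul_const (d + d)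
    refine squeeze_zero_norm (fun N => ?_) hinv
    rw [norm_smul, Real.norm_of_nonneg (by positivity)]
    gcongr
    exact norm_sub_le_of_le (hx _) (hx _)
  obtain ⟨y, -, φ, hφ, hy⟩ := (isCompact_closedBall (0 : E) d).tendsto_subseq hmean_ball
  refine ⟨y, hclosed.mem_of_tendsto (hy.prodMk_nhds ?_)
    (Eventually.of_forall fun N => hmean_mem (φ N))⟩
  simpa using hy.add (hshift.comp hφ.tendsto_atTop)

/-- If the conjunctive linear loop program `{(x,x') : A (x;x') ≤ b}` has a bounded
infinite execution, then it has a geometric nontermination argument of size 0,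
i.e., there is a point `x*` with `A (x*;x*) ≤ b`. -/
theorem bounded_infinite_execution_gnta_size_zero {n m : ℕ}
    (A : Matrix (Fin m) (Fin n ⊕ Fin n) ℝ) (b : Fin m → ℝ)
    (x : ℕ → EuclideanSpace ℝ (Fin n)) (d : ℝ)
    (hexec : ∀ t : ℕ, A *ᵥ Sum.elim (x t) (x (t + 1)) ≤ b)
    (hbound : ∀ t : ℕ, ‖x t‖ ≤ d) :
    ∃ xstar : EuclideanSpace ℝ (Fin n), A *ᵥ Sum.elim xstar xstar ≤ b := by
  let L : EuclideanSpace ℝ (Fin n) × EuclideanSpace ℝ (Fin n) →ₗ[ℝ] (Fin m → ℝ) :=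
    { toFun := fun p => A *ᵥ Sum.elim p.1 p.2
      map_add' := fun p q => by
        rw [← mulVec_add]
        congr 1
        ext (i | i) <;> simp
      map_smul' := fun c p => by
        rw [RingHom.id_apply, ← mulVec_smul]
        congr 1
        ext (i | i) <;> simp }
  exact exists_diagonal_mem_of_bounded_orbit (S := L ⁻¹' Set.Iic b)
    ((convex_Iic b).linear_preimage L)
    (isClosed_Iic.preimage L.continuous_of_finiteDimensional) x d hexec hbound
end

section
/- Let a deterministic linear loop program over ℝ^n be given by G ∈ ℝ^{m×n}, g ∈ ℝ^m, update matrix M = I + N where N ∈ ℝ^{n×n} is nilpotent with nilpotence index k (i.e., N^k = 0 and N^{k-1} ≠ 0), and update vector c ∈ ℝ^n. If G N^{k-1} c ≰ 0 (i.e., some component of the vector G N^{k-1} c is strictly positive), then the loop is terminating: there is no infinite sequence x_1, x_2, … in ℝ^n with G x_t ≤ g and x_{t+1} = (I + N) x_t + c for all t ≥ 1. -/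
open Matrix

/-- A real sequence whose increments are eventually bounded below by a positive constant
tends to infinity. -/
theorem tendsto_atTop_of_eventually_le_sub {s : ℕ → ℝ} {a : ℝ} (ha : 0 < a)
    (h : ∀ᶠ t in Filter.atTop, a ≤ s (t + 1) - s t) :
    Filter.Tendsto s Filter.atTop Filter.atTop := by
  obtain ⟨T, hT⟩ := Filter.eventually_atTop.1 h
  have key : ∀ u : ℕ, s T + u * a ≤ s (u + T) := by
    intro u
    induction u with
    | zero => simp
    | succ u ih =>
      have h1 := hT (u + T) (by omega)
      rw [show u + 1 + T = u + T + 1 by omega]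
      push_cast
      linarith
  rw [← Filter.tendsto_add_atTop_iff_nat T]
  exact Filter.tendsto_atTop_mono key (Filter.tendsto_atTop_add_const_left _ _
    (tendsto_natCast_atTop_atTop.atTop_mul_const ha))

/-- **Deterministic loops with eigenvalue 1.**
Let the update matrix be `M = I + N` with `N` nilpotent of nilpotence index `k`.
If `G N^{k-1} c ≰ 0`, then the loop `while (Gx ≤ g) do x := (I+N)x + c` terminates. -/
theorem eigenvalue_one_terminating {n m : ℕ}
    (G : Matrix (Fin m) (Fin n) ℝ) (g : Fin m → ℝ)
    (N : Matrix (Fin n) (Fin n) ℝ) (c : Fin n → ℝ) (k : ℕ)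
    (hNk : N ^ k = 0) (hNk1 : N ^ (k - 1) ≠ 0)
    (hpos : ¬ (G *ᵥ (N ^ (k - 1) *ᵥ c) ≤ 0)) :
    ¬ ∃ x : ℕ → Fin n → ℝ,
        ∀ t : ℕ, G *ᵥ x t ≤ g ∧ x (t + 1) = (1 + N) *ᵥ x t + c := by
  rintro ⟨x, hx⟩
  obtain ⟨i, hi⟩ : ∃ i, 0 < (G *ᵥ (N ^ (k - 1) *ᵥ c)) i := by
    simpa [Pi.le_def] using hpos
  obtain ⟨l, rfl⟩ : ∃ l, k = l + 1 := by
    cases k with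
    | zero => exact absurd hNk hNk1
    | succ l => exact ⟨l, rfl⟩
  rw [Nat.add_sub_cancel] at hi
  have hstep : ∀ t, x (t + 1) = x t + (N *ᵥ x t + c) := fun t => by
    rw [(hx t).2, add_mulVec, one_mulVec, add_assoc]
  have hdiff : ∀ t, N *ᵥ x (t + 1) + c = (N *ᵥ x t + c) + N *ᵥ (N *ᵥ x t + c) := fun t => by
    rw [hstep t, mulVec_add N (x t)]
    abel
  have hbound : ∀ j ≤ l, ∀ᶠ t in Filter.atTop,
      (G *ᵥ (N ^ l *ᵥ c)) i ≤ (G *ᵥ (N ^ j *ᵥ (N *ᵥ x t + c))) i := by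
    intro j hj
    induction hj using Nat.decreasingInduction with
    | self =>
      refine Filter.Eventually.of_forall fun t => le_of_eq ?_
      rw [mulVec_add, mulVec_mulVec _ (N ^ l) N, ← pow_succ, hNk, zero_mulVec, zero_add]
    | of_succ j hj ih =>
      refine (tendsto_atTop_of_eventually_le_sub hi (ih.mono fun t ht => ?_)).eventually_ge_atTop _
      rw [hdiff t, mulVec_add (N ^ j), mulVec_add G, mulVec_mulVec _ (N ^ j) N, ← pow_succ,
        Pi.add_apply, add_sub_cancel_left]
      exact ht
  have hlim : Filter.Tendsto (fun t => (G *ᵥ x t) i) Filter.atTop Filter.atTop := by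
    refine tendsto_atTop_of_eventually_le_sub hi ((hbound 0 (Nat.zero_le l)).mono fun t ht => ?_)
    rw [hstep t, mulVec_add G, Pi.add_apply, add_sub_cancel_left]
    simpa using ht
  obtain ⟨t, ht⟩ := (hlim.eventually_gt_atTop (g i)).exists
  exact absurd ((hx t).1 i) (not_le.2 ht)
end

section
/- Let G ∈ ℝ^{m×n}, g ∈ ℝ^m, let N ∈ ℝ^{n×n} be nilpotent with N^k = 0, and let c ∈ ℝ^n. Suppose there is a row index r such that, writing h^T for the r-th row of G and h_0 for the r-th component of g, one has δ := h^T N^{k-1} c > 0. Then there exist constants c_1, …, c_k ∈ ℝ such that the affine-linear functions f_j(x) := −h^T N^{k−j} x + c_j (for 1 ≤ j ≤ k) satisfy: (i) f_k(x) > 0 for every x with G x ≤ g; (ii) f_1(x') ≤ f_1(x) − δ for every x and x' = (I + N) x + c; (iii) f_j(x') < f_j(x) + f_{j−1}(x) for every 1 < j ≤ k, every x, and x' = (I + N) x + c. -/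
open Matrix

theorem dotProduct_pow_mulVec_step {ι R : Type*} [Fintype ι] [DecidableEq ι] [Semiring R]
    (h : ι → R) (N : Matrix ι ι R) (c x : ι → R) (a : ℕ) :
    h ⬝ᵥ (N ^ a *ᵥ ((1 + N) *ᵥ x + c)) =
      h ⬝ᵥ (N ^ a *ᵥ x) + h ⬝ᵥ (N ^ (a + 1) *ᵥ x) + h ⬝ᵥ (N ^ a *ᵥ c) := by
  simp only [mulVec_add, add_mulVec, one_mulVec, mulVec_mulVec, dotProduct_add, pow_succ]

/-- **A k-nested ranking function.**
If `h^T` is the `r`-th row of `G`, `h₀` the `r`-th component of `g`, `N` is nilpotent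
with `N^k = 0`, and `δ := h^T N^{k-1} c > 0`, then there are constants `c₁, …, c_k`
such that the functions `f_j(x) = −h^T N^{k−j} x + c_j` form a k-nested ranking
function for the loop `while (Gx ≤ g) do x := (I+N)x + c`. -/
theorem nested_ranking_function {n m : ℕ}
    (G : Matrix (Fin m) (Fin n) ℝ) (g : Fin m → ℝ)
    (N : Matrix (Fin n) (Fin n) ℝ) (c : Fin n → ℝ) (k : ℕ)
    (hNk : N ^ k = 0) (r : Fin m)
    (hdelta : 0 < G r ⬝ᵥ (N ^ (k - 1) *ᵥ c)) :
    ∃ cs : ℕ → ℝ,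
      -- with `f j x := −h^T N^{k−j} x + cs j`:
      letI f : ℕ → (Fin n → ℝ) → ℝ := fun j x => -(G r ⬝ᵥ (N ^ (k - j) *ᵥ x)) + cs j
      -- (i) `f_k(x) > 0` for every `x` satisfying the guard
      (∀ x : Fin n → ℝ, G *ᵥ x ≤ g → 0 < f k x) ∧
      -- (ii) `f_1(x') ≤ f_1(x) − δ` for `x' = (I+N)x + c`
      (∀ x : Fin n → ℝ,
        f 1 ((1 + N) *ᵥ x + c) ≤ f 1 x - G r ⬝ᵥ (N ^ (k - 1) *ᵥ c)) ∧
      -- (iii) `f_j(x') < f_j(x) + f_{j−1}(x)` for `1 < j ≤ k` and `x' = (I+N)x + c`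
      (∀ j : ℕ, 1 < j → j ≤ k → ∀ x : Fin n → ℝ,
        f j ((1 + N) *ᵥ x + c) < f j x + f (j - 1) x) := by
  have hk : 1 ≤ k := by
    rcases Nat.eq_zero_or_pos k with rfl | h
    · rw [Nat.zero_sub, hNk, zero_mulVec, dotProduct_zero] at hdelta
      exact absurd hdelta (lt_irrefl 0)
    · exact h
  refine ⟨fun j => if j = k then g r + 1 else 1 - G r ⬝ᵥ (N ^ (k - (j + 1)) *ᵥ c), ?_, ?_, ?_⟩
  · intro x hx
    have h : G r ⬝ᵥ x ≤ g r := hx r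
    simp only [Nat.sub_self, pow_zero, one_mulVec, if_true]
    linarith
  · intro x
    have h : k - 1 + 1 = k := by omega
    simp only [dotProduct_pow_mulVec_step, h, hNk, zero_mulVec, dotProduct_zero]
    linarith
  · intro j hj hjk x
    have h1 : k - (j - 1) = k - j + 1 := by omega
    have h2 : j - 1 ≠ k := by omega
    have h3 : j - 1 + 1 = j := by omega
    simp only [dotProduct_pow_mulVec_step, h1, h3, if_neg h2]
    linarith
end
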